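/- arXiv:2206.10712 — 3 statements merged into one kernel-verified Lean document; each statement's English description precedes it below -/
import Mathlib

section
/- For every countably infinite group G, the space L(G) of integer-valued length functions on G, endowed with the topology of pointwise convergence, is a perfect Polish space (i.e., it is separable, completely metrizable, and has no isolated points). -/
open Set Function Pointwise

section Defs

variable {G : Type*} [Group G]

/-- A length function on a group. -/
def IsLengthFun (ℓ : G → ℕ) : Prop :=
  (∀ g : G, ℓ g = 0 ↔ g = 1) ∧ (∀ g : G, ℓ g⁻¹ = ℓ g) ∧ ∀ g h : G, ℓ (g * h) ≤ ℓ g + ℓ h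

/-- The space of length functions, topologized as a subspace of `G → ℕ`. -/
abbrev LengthFun (G : Type*) [Group G] : Type _ := {ℓ : G → ℕ // IsLengthFun ℓ}

/-- Word length with respect to a generating set `X`. -/
noncomputable def wordLength (X : Set G) (g : G) : ℕ :=
  sInf {n : ℕ | ∃ w : List G, w.length = n ∧ (∀ x ∈ w, x ∈ X ∨ x⁻¹ ∈ X) ∧ w.prod = g}

/-- A length function is a word length. -/
def IsWordLength (ℓ : G → ℕ) : Prop :=
  ∃ X : Set G, Subgroup.closure X = ⊤ ∧ ∀ g : G, ℓ g = wordLength X g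

/-- Mixed identity free group. -/
def MIF (G : Type*) [Group G] : Prop :=
  ∀ w : Monoid.Coprod G (FreeGroup Unit), w ≠ 1 →
    ∃ g : G, Monoid.Coprod.lift (MonoidHom.id G) (FreeGroup.lift fun _ => g) w ≠ 1

/-- The length function associated to a weight function `ω`. -/
noncomputable def weightLength (ω : G → ℕ) (g : G) : ℕ :=
  sInf {N : ℕ | ∃ w : List (G × Bool),
    (w.map fun p => ω p.1).sum = N ∧
    (w.map fun p => if p.2 then p.1 else p.1⁻¹).prod = g}

/-- `(ℓ, a)`-consistency of a tuple of distances. -/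
def Consistent (ℓ : G → ℕ) {n : ℕ} (a : Fin n → G) (d : Fin n → ℕ) : Prop :=
  ∀ i j : Fin n, d i ≤ ℓ ((a i)⁻¹ * a j) + d j ∧ ℓ ((a i)⁻¹ * a j) ≤ d i + d j

/-- The bi-Lipschitz preorder on length functions. -/
def Preceq (ℓ₁ ℓ₂ : G → ℕ) : Prop :=
  ∃ C : ℕ, ∀ g : G, g ≠ 1 → ℓ₁ g ≤ C * ℓ₂ g

/-- The conjugacy action of `G` on its space of length functions. -/
def conjLF (g : G) (ℓ : LengthFun G) : LengthFun G :=
  ⟨fun x => ℓ.1 (g⁻¹ * x * g), by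
    obtain ⟨h1, h2, h3⟩ := ℓ.2
    refine ⟨fun x => ?_, fun x => ?_, fun x y => ?_⟩
    · rw [h1]
      constructor
      · intro h
        have := congrArg (fun z => g * z * g⁻¹) h
        simpa [mul_assoc] using this
      · rintro rfl; simp
    · show ℓ.1 (g⁻¹ * x⁻¹ * g) = ℓ.1 (g⁻¹ * x * g)
      have h : g⁻¹ * x⁻¹ * g = (g⁻¹ * x * g)⁻¹ := by group
      rw [h, h2]
    · show ℓ.1 (g⁻¹ * (x * y) * g) ≤ ℓ.1 (g⁻¹ * x * g) + ℓ.1 (g⁻¹ * y * g)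
      have h : g⁻¹ * (x * y) * g = (g⁻¹ * x * g) * (g⁻¹ * y * g) := by group
      rw [h]
      exact h3 _ _⟩

/-- Topological transitivity of the conjugacy action on `LengthFun G`. -/
def ConjTopTransitive (G : Type*) [Group G] : Prop :=
  ∀ U V : Set (LengthFun G), IsOpen U → IsOpen V → U.Nonempty → V.Nonempty →
    ∃ g : G, ((conjLF g '' U) ∩ V).Nonempty

end Defs

/-- The language with one binary function symbol and countably many unary predicates. -/
def lengthLang : FirstOrder.Language where
  Functions := fun n => match n with | 2 => Unit | _ => Empty
  Relations := fun n => match n with | 1 => ℕ | _ => Empty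

/-- The `lengthLang`-structure on `G` associated to a length function `ℓ`. -/
def lengthStructure {G : Type*} [Group G] (ℓ : G → ℕ) : lengthLang.Structure G where
  funMap {n} f x :=
    match n, f, x with
    | 2, _, x => x 0 * x 1
  RelMap {n} r x :=
    match n, r, x with
    | 1, i, x => ℓ (x 0) = i

section LengthFunctions

variable {G : Type*} [Group G]

theorem isClosed_setOf_isLengthFun : IsClosed {ℓ : G → ℕ | IsLengthFun ℓ} := by
  have hc (g : G) : Continuous fun ℓ : G → ℕ => ℓ g := continuous_apply g
  have h1 : IsClosed {ℓ : G → ℕ | ∀ g : G, ℓ g = 0 ↔ g = 1} := by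
    simp only [ofPred_forall]
    exact isClosed_iInter fun g =>
      (isClosed_discrete {n : ℕ | n = 0 ↔ g = 1}).preimage (hc g)
  have h2 : IsClosed {ℓ : G → ℕ | ∀ g : G, ℓ g⁻¹ = ℓ g} := by
    simp only [ofPred_forall]
    exact isClosed_iInter fun g => isClosed_eq (hc _) (hc _)
  have h3 : IsClosed {ℓ : G → ℕ | ∀ g h : G, ℓ (g * h) ≤ ℓ g + ℓ h} := by
    simp only [ofPred_forall]
    exact isClosed_iInter fun g => isClosed_iInter fun h =>
      isClosed_le (hc _) ((hc _).add (hc _))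
  exact h1.inter (h2.inter h3)

theorem IsLengthFun.min_const {ℓ : G → ℕ} (hℓ : IsLengthFun ℓ) {N : ℕ} (hN : 0 < N) :
    IsLengthFun fun g => min (ℓ g) N := by
  obtain ⟨h1, h2, h3⟩ := hℓ
  refine ⟨fun g => ?_, fun g => ?_, fun g h => ?_⟩
  · rw [← h1 g]
    dsimp only
    omega
  · simp only [h2]
  · have := h3 g h
    dsimp only
    omega

/-- The least total weight of a word representing `g`. -/
noncomputable def minWeight (ω : G → ℕ) (g : G) : ℕ :=
  sInf {n : ℕ | ∃ w : List G, w.prod = g ∧ (w.map ω).sum = n}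

theorem exists_word_minWeight (ω : G → ℕ) (g : G) :
    ∃ w : List G, w.prod = g ∧ (w.map ω).sum = minWeight ω g :=
  Nat.sInf_mem (s := {n : ℕ | ∃ w : List G, w.prod = g ∧ (w.map ω).sum = n})
    ⟨_, [g], by simp, rfl⟩

theorem minWeight_prod_le (ω : G → ℕ) (w : List G) : minWeight ω w.prod ≤ (w.map ω).sum :=
  Nat.sInf_le ⟨w, rfl, rfl⟩

theorem minWeight_le (ω : G → ℕ) (g : G) : minWeight ω g ≤ ω g := by
  simpa using minWeight_prod_le ω [g]

theorem IsLengthFun.prod_le {ℓ : G → ℕ} (hℓ : IsLengthFun ℓ) (w : List G) :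
    ℓ w.prod ≤ (w.map ℓ).sum := by
  induction w with
  | nil => simp [(hℓ.1 1).2 rfl]
  | cons x w ih =>
    simp only [List.prod_cons, List.map_cons, List.sum_cons]
    exact (hℓ.2.2 _ _).trans (by omega)

theorem IsLengthFun.le_minWeight {ℓ ω : G → ℕ} (hℓ : IsLengthFun ℓ) (hω : ∀ g, ℓ g ≤ ω g)
    (g : G) : ℓ g ≤ minWeight ω g := by
  obtain ⟨w, rfl, hw⟩ := exists_word_minWeight ω g
  rw [← hw]
  exact (hℓ.prod_le w).trans (List.sum_le_sum fun x _ => hω x)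

theorem minWeight_inv_le {ω : G → ℕ} (hω : ∀ g, ω g⁻¹ = ω g) (g : G) :
    minWeight ω g⁻¹ ≤ minWeight ω g := by
  obtain ⟨w, rfl, hw⟩ := exists_word_minWeight ω g
  rw [← hw, List.prod_inv_reverse]
  refine (minWeight_prod_le ω _).trans_eq ?_
  simp [List.map_reverse, List.sum_reverse, Function.comp_def, hω]

theorem IsLengthFun.minWeight {ℓ ω : G → ℕ} (hℓ : IsLengthFun ℓ) (hle : ∀ g, ℓ g ≤ ω g)
    (hω : ∀ g, ω g⁻¹ = ω g) : IsLengthFun (minWeight ω) := by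
  refine ⟨fun g => ⟨fun h => ?_, ?_⟩, fun g => ?_, fun g h => ?_⟩
  · exact (hℓ.1 g).1 (Nat.le_zero.1 (h ▸ hℓ.le_minWeight hle g))
  · rintro rfl
    simpa using minWeight_prod_le ω []
  · refine (minWeight_inv_le hω g).antisymm ?_
    simpa using minWeight_inv_le hω g⁻¹
  · obtain ⟨v, rfl, hv⟩ := exists_word_minWeight ω g
    obtain ⟨w, rfl, hw⟩ := exists_word_minWeight ω h
    rw [← hv, ← hw]
    simpa using minWeight_prod_le ω (v ++ w)

theorem finite_setOf_prod_word {S : Set G} (hS : S.Finite) (n : ℕ) :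
    {g : G | ∃ w : List G, w.length ≤ n ∧ (∀ x ∈ w, x ∈ S) ∧ w.prod = g}.Finite := by
  have := hS.to_subtype
  refine ((List.finite_length_le S n).image fun w => (w.map Subtype.val).prod).subset ?_
  rintro _ ⟨w, hn, hw, rfl⟩
  exact ⟨w.attachWith (· ∈ S) hw, by simpa using hn, by simp⟩

/-- Making every letter outside a finite set expensive turns a bounded length function into an
unbounded one. -/
theorem IsLengthFun.exists_ne_eqOn_of_bounded [Infinite G] {ℓ : G → ℕ} (hℓ : IsLengthFun ℓ)
    {M : ℕ} (hM : ∀ g, ℓ g ≤ M) {F : Set G} (hF : F.Finite) :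
    ∃ ℓ' : G → ℕ, IsLengthFun ℓ' ∧ EqOn ℓ' ℓ F ∧ ℓ' ≠ ℓ := by
  classical
  let ω : G → ℕ := fun g => if g ∈ F ∪ F⁻¹ then max (ℓ g) 1 else M + 1
  have hle (g : G) : ℓ g ≤ ω g := by
    have := hM g
    dsimp only [ω]
    split_ifs <;> omega
  have hpos (g : G) : 1 ≤ ω g := by
    dsimp only [ω]
    split_ifs <;> omega
  have hinv (g : G) : ω g⁻¹ = ω g := by
    simp only [ω, mem_union, Set.mem_inv, inv_inv, hℓ.2.1, or_comm]
  have hlen := hℓ.minWeight hle hinv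
  refine ⟨_root_.minWeight ω, hlen, fun g hg => ?_, fun heq => ?_⟩
  · by_cases h1 : g = 1
    · rw [(hlen.1 g).2 h1, (hℓ.1 g).2 h1]
    · refine le_antisymm ((minWeight_le ω g).trans ?_) (hℓ.le_minWeight hle g)
      have : ℓ g ≠ 0 := mt (hℓ.1 g).1 h1
      simp only [ω, mem_union, hg, true_or, if_true]
      omega
  · refine Set.infinite_univ ((finite_setOf_prod_word (hF.union hF.inv) M).subset fun g _ => ?_)
    obtain ⟨w, hg, hw⟩ := exists_word_minWeight ω g
    have hwM : (w.map ω).sum ≤ M := by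
      rw [hw, heq]
      exact hM g
    refine ⟨w, ?_, fun x hx => ?_, hg⟩
    · have := List.card_nsmul_le_sum (w.map ω) 1 (by simp [hpos])
      simp only [List.length_map, smul_eq_mul, mul_one] at this
      omega
    · by_contra hxF
      have := List.le_sum_of_mem (List.mem_map_of_mem (f := ω) hx)
      simp only [ω, if_neg hxF] at this hwM
      omega

theorem IsLengthFun.exists_ne_eqOn [Infinite G] {ℓ : G → ℕ} (hℓ : IsLengthFun ℓ)
    {F : Set G} (hF : F.Finite) :
    ∃ ℓ' : G → ℕ, IsLengthFun ℓ' ∧ EqOn ℓ' ℓ F ∧ ℓ' ≠ ℓ := by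
  by_cases hb : ∃ M, ∀ g, ℓ g ≤ M
  · obtain ⟨M, hM⟩ := hb
    exact hℓ.exists_ne_eqOn_of_bounded hM hF
  · obtain ⟨N, hN⟩ := (hF.image ℓ).bddAbove
    push Not at hb
    obtain ⟨g, hg⟩ := hb (N + 1)
    refine ⟨_, hℓ.min_const N.succ_pos, fun x hx => ?_, fun heq => ?_⟩
    · exact min_eq_left ((hN (mem_image_of_mem ℓ hx)).trans N.le_succ)
    · have := congrFun heq g
      omega

end LengthFunctions

theorem stmt0 (G : Type) [Group G] [Countable G] [Infinite G] :
    PolishSpace (LengthFun G) ∧ ∀ ℓ : LengthFun G, (nhdsWithin ℓ {ℓ}ᶜ).NeBot := by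
  refine ⟨isClosed_setOf_isLengthFun.polishSpace, fun ℓ => ?_⟩
  rw [← mem_closure_iff_nhdsWithin_neBot, mem_closure_iff]
  rintro U hU hℓU
  obtain ⟨V, hV, rfl⟩ := isOpen_induced_iff.1 hU
  obtain ⟨I, u, hu, hIV⟩ := isOpen_pi_iff.1 hV ℓ.1 hℓU
  obtain ⟨ℓ', hℓ', heq, hne⟩ := ℓ.2.exists_ne_eqOn I.finite_toSet
  refine ⟨⟨ℓ', hℓ'⟩, hIV fun g hg => ?_, fun h => hne (congrArg Subtype.val h)⟩
  change ℓ' g ∈ u g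
  rw [heq hg]
  exact (hu g hg).2
end

section
/- Let G be a countable MIF group. Then the set of ℓ ∈ L(G) such that ℓ is a word length is comeager in L(G). -/
open Set Function Pointwise

section FreeProduct

open Monoid
open scoped commutatorElement

/-- A nontrivial element represented by a reduced word is nontrivial. -/
theorem NeWord.prod_ne_one {ι : Type*} {M : ι → Type*} [∀ i, Group (M i)] {i j : ι}
    (w : CoprodI.NeWord M i j) : w.prod ≠ 1 := by
  classical
  intro h
  have h1 : w.toWord = CoprodI.Word.empty := by
    apply CoprodI.Word.equiv.symm.injective
    exact (show w.toWord.prod = 1 from h).trans CoprodI.Word.prod_empty.symm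
  exact w.toList_ne_nil (congrArg CoprodI.Word.toList h1)

/-- If the factor at `false` is infinite, every nontrivial element of a free product of two groups
has a conjugate represented by a reduced word which starts and ends in this factor. -/
theorem exists_conj_eq_neWord_prod {M : Bool → Type*} [∀ b, Group (M b)] [Infinite (M false)]
    {w : CoprodI M} (hw : w ≠ 1) :
    ∃ (v : CoprodI M) (W : CoprodI.NeWord M false false), W.prod = v * w * v⁻¹ := by
  classical
  have mixed : ∀ W : CoprodI.NeWord M false true,
      ∃ (v : CoprodI M) (W' : CoprodI.NeWord M false false), W'.prod = v * W.prod * v⁻¹ := by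
    intro W
    obtain ⟨t, ht⟩ := Infinite.exists_notMem_finset ({1, W.head⁻¹} : Finset (M false))
    simp only [Finset.mem_insert, Finset.mem_singleton, not_or] at ht
    have h1 : t * W.head ≠ 1 := fun h => ht.2 (eq_inv_of_mul_eq_one_left h)
    exact ⟨CoprodI.of t, (W.mulHead t h1).append (by simp)
      (.singleton t⁻¹ (inv_ne_one.mpr ht.1)), by simp⟩
  have hw' : CoprodI.Word.equiv w ≠ CoprodI.Word.empty := by
    intro h
    apply hw
    rw [← CoprodI.Word.equiv.symm_apply_apply w, h]
    simp [CoprodI.Word.equiv]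
  obtain ⟨i, j, W, hW⟩ := CoprodI.NeWord.of_word _ hw'
  have hWw : W.prod = w := by
    rw [CoprodI.NeWord.prod, hW]
    exact CoprodI.Word.equiv.symm_apply_apply w
  subst hWw
  cases i <;> cases j
  · exact ⟨1, W, by simp⟩
  · exact mixed W
  · obtain ⟨v, W', h⟩ := mixed W.inv
    exact ⟨v, W'.inv, by simp [h, mul_assoc]⟩
  · obtain ⟨t, ht⟩ := exists_ne (1 : M false)
    exact ⟨CoprodI.of t, ((CoprodI.NeWord.singleton t ht).append (by simp) W).append (by simp)
      (.singleton t⁻¹ (inv_ne_one.mpr ht)), by simp⟩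

/-- Two nontrivial elements of a free product do not commute, after conjugating one of them. -/
theorem CoprodI.exists_commutator_conj_ne_one {M : Bool → Type*} [∀ b, Group (M b)]
    [Infinite (M false)] [Nontrivial (M true)] {w₁ w₂ : CoprodI M} (h₁ : w₁ ≠ 1) (h₂ : w₂ ≠ 1) :
    ∃ u : CoprodI M, ⁅w₁, u * w₂ * u⁻¹⁆ ≠ 1 := by
  obtain ⟨v₁, W₁, hW₁⟩ := exists_conj_eq_neWord_prod h₁
  obtain ⟨v₂, W₂, hW₂⟩ := exists_conj_eq_neWord_prod h₂
  obtain ⟨a, ha⟩ := exists_ne (1 : M true)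
  let A : CoprodI.NeWord M true true := .singleton a ha
  let U : CoprodI.NeWord M true true :=
    (A.append (by simp) W₂).append (by simp) A.inv
  let C : CoprodI.NeWord M false true :=
    ((W₁.append (by simp) U).append (by simp) W₁.inv).append (by simp) U.inv
  refine ⟨v₁⁻¹ * CoprodI.of a * v₂, fun h => NeWord.prod_ne_one C ?_⟩
  have hC : C.prod = v₁ * ⁅w₁, v₁⁻¹ * CoprodI.of a * v₂ * w₂ * (v₁⁻¹ * CoprodI.of a * v₂)⁻¹⁆ *
      v₁⁻¹ := by
    simp only [C, U, A, CoprodI.NeWord.append_prod, CoprodI.NeWord.inv_prod, hW₁, hW₂,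
      CoprodI.NeWord.prod_singleton, commutatorElement_def]
    group
  rw [hC, h]
  group

/-- The family of groups indexed by `Bool` with members `A` and `B`. -/
def boolFamily.{u, v} (A : Type u) (B : Type v) : Bool → Type max u v
  | true => ULift.{v} A
  | false => ULift.{u} B

instance (A B : Type*) [Group A] [Group B] : ∀ b, Group (boolFamily A B b)
  | true => inferInstanceAs (Group (ULift A))
  | false => inferInstanceAs (Group (ULift B))

instance (A B : Type*) [Infinite B] : Infinite (boolFamily A B false) :=
  inferInstanceAs (Infinite (ULift B))

instance (A B : Type*) [Nontrivial A] : Nontrivial (boolFamily A B true) :=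
  inferInstanceAs (Nontrivial (ULift A))

/-- The binary free product is the free product of the family `boolFamily`. -/
noncomputable def coprodMulEquiv (A B : Type*) [Group A] [Group B] :
    Coprod A B ≃* CoprodI (boolFamily A B) :=
  MonoidHom.toMulEquiv
    (Coprod.lift
      ((CoprodI.of (M := boolFamily A B) (i := true)).comp
        (MulEquiv.ulift (α := A)).symm.toMonoidHom)
      ((CoprodI.of (M := boolFamily A B) (i := false)).comp
        (MulEquiv.ulift (α := B)).symm.toMonoidHom))
    (CoprodI.lift fun b => match b with
      | true => Coprod.inl.comp (MulEquiv.ulift (α := A)).toMonoidHom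
      | false => Coprod.inr.comp (MulEquiv.ulift (α := B)).toMonoidHom)
    (by
      apply Coprod.hom_ext <;> ext x <;>
      simp only [MonoidHom.comp_apply, Coprod.lift_apply_inl, Coprod.lift_apply_inr] <;> rfl)
    (by
      apply CoprodI.ext_hom
      rintro (_ | _) <;> ext x <;> simp only [MonoidHom.comp_apply, CoprodI.lift_of] <;> rfl)

theorem Coprod.exists_commutator_conj_ne_one {A B : Type*} [Group A] [Group B] [Nontrivial A]
    [Infinite B] {w₁ w₂ : Coprod A B} (h₁ : w₁ ≠ 1) (h₂ : w₂ ≠ 1) :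
    ∃ u : Coprod A B, ⁅w₁, u * w₂ * u⁻¹⁆ ≠ 1 := by
  let e := coprodMulEquiv A B
  obtain ⟨u, hu⟩ := CoprodI.exists_commutator_conj_ne_one
    (e.map_ne_one_iff.mpr h₁) (e.map_ne_one_iff.mpr h₂)
  refine ⟨e.symm u, fun h => hu ?_⟩
  simpa [commutatorElement_def] using congrArg e h

end FreeProduct

section MixedIdentities

open Monoid
open scoped commutatorElement

variable {G : Type*} [Group G]

/-- Evaluation of a word with constants at `h`. -/
def evalAt (h : G) : Coprod G (FreeGroup Unit) →* G :=
  Coprod.lift (MonoidHom.id G) (FreeGroup.lift fun _ => h)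

@[simp]
theorem evalAt_inl (h g : G) : evalAt h (Coprod.inl g) = g := by simp [evalAt]

@[simp]
theorem evalAt_inr_of (h : G) (u : Unit) : evalAt h (Coprod.inr (FreeGroup.of u)) = h := by
  simp [evalAt]

theorem MIF.nontrivial (hG : MIF G) : Nontrivial G := by
  have hx : (Coprod.inr (FreeGroup.of ()) : Coprod G (FreeGroup Unit)) ≠ 1 := by
    intro h
    exact FreeGroup.of_ne_one () (by simpa using congrArg Coprod.snd h)
  obtain ⟨g, hg⟩ := hG _ hx
  exact nontrivial_of_ne _ _ hg

/-- In an MIF group, finitely many nontrivial words with constants do not vanish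
simultaneously. -/
theorem MIF.exists_forall_evalAt_ne_one (hG : MIF G) {S : Set (Coprod G (FreeGroup Unit))}
    (hS : S.Finite) (h1 : ∀ w ∈ S, w ≠ 1) : ∃ h : G, ∀ w ∈ S, evalAt h w ≠ 1 := by
  have := hG.nontrivial
  suffices H : ∃ v : Coprod G (FreeGroup Unit), v ≠ 1 ∧
      ∀ h : G, evalAt h v ≠ 1 → ∀ w ∈ S, evalAt h w ≠ 1 by
    obtain ⟨v, hv, hvS⟩ := H
    obtain ⟨h, hh⟩ := hG v hv
    exact ⟨h, hvS h hh⟩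
  induction S, hS using Set.Finite.induction_on with
  | empty =>
    obtain ⟨a, ha⟩ := exists_ne (1 : G)
    exact ⟨Coprod.inl a, fun h => ha (by simpa using congrArg Coprod.fst h), by simp⟩
  | @insert w S _ _ ih =>
    obtain ⟨v, hv, hvS⟩ := ih fun w' hw' => h1 w' (Set.mem_insert_of_mem _ hw')
    obtain ⟨u, hu⟩ := Coprod.exists_commutator_conj_ne_one (h1 w (Set.mem_insert _ _)) hv
    refine ⟨_, hu, fun h hh => ?_⟩
    rintro w' (rfl | hw') hw1
    · exact hh (by simp [commutatorElement_def, hw1])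
    · refine hvS h (fun hv1 => hh ?_) w' hw' hw1
      simp [commutatorElement_def, hv1]

end MixedIdentities

section Isometries

open Monoid

/-- The permutations of `G → ℤ` which preserve uniform distances. -/
def uniformIsometries (G : Type*) : Subgroup (Equiv.Perm (G → ℤ)) where
  carrier := {σ | ∀ (φ ψ : G → ℤ) (m : ℕ),
    (∀ k, |σ φ k - σ ψ k| ≤ m) ↔ ∀ k, |φ k - ψ k| ≤ m}
  one_mem' := fun _ _ _ => Iff.rfl
  mul_mem' := fun {σ τ} hσ hτ φ ψ m => (hσ (τ φ) (τ ψ) m).trans (hτ φ ψ m)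
  inv_mem' := fun {σ} hσ φ ψ m => by
    simpa using (hσ (σ⁻¹ φ) (σ⁻¹ ψ) m).symm

/-- Addition of `φ`, as a uniform isometry. -/
def addIsometry {G : Type*} (φ : G → ℤ) : uniformIsometries G :=
  ⟨Equiv.addRight φ, fun ψ χ m => by simp⟩

theorem addIsometry_apply {G : Type*} (φ ψ : G → ℤ) (k : G) :
    (addIsometry φ : Equiv.Perm (G → ℤ)) ψ k = ψ k + φ k :=
  rfl

theorem addIsometry_inv {G : Type*} (φ : G → ℤ) : (addIsometry φ)⁻¹ = addIsometry (-φ) := by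
  rw [inv_eq_iff_mul_eq_one]
  ext ψ k
  simp [addIsometry_apply]

variable {G : Type*} [Group G]

/-- The action of `G` on `G → ℤ` by left translation of the argument. -/
def shiftHom (G : Type*) [Group G] : G →* uniformIsometries G where
  toFun g := ⟨(Equiv.mulLeft g).arrowCongr (Equiv.refl ℤ), fun φ ψ m => by
    simpa using (Equiv.mulLeft g⁻¹).forall_congr_right (q := fun k => |φ k - ψ k| ≤ m)⟩
  map_one' := by ext φ k; exact congrArg φ (show (1 : G)⁻¹ * k = k by simp)
  map_mul' g h := by
    ext φ k
    exact congrArg φ (show (g * h)⁻¹ * k = h⁻¹ * (g⁻¹ * k) by simp [mul_assoc])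

theorem shiftHom_apply (g : G) (φ : G → ℤ) (k : G) :
    (shiftHom G g : Equiv.Perm (G → ℤ)) φ k = φ (g⁻¹ * k) := by
  simp [shiftHom]

/-- The action of `G ∗ ⟨x⟩` on `G → ℤ` with `G` acting by shifts and `x` by adding `φ`. -/
def affineHom (φ : G → ℤ) : Coprod G (FreeGroup Unit) →* uniformIsometries G :=
  Coprod.lift (shiftHom G) (FreeGroup.lift fun _ => addIsometry φ)

/-- The element `w` displaces the point `p` by at most `m`. -/
def DisplacesLE (φ p : G → ℤ) (w : Coprod G (FreeGroup Unit)) (m : ℕ) : Prop :=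
  ∀ k, |(affineHom φ w : Equiv.Perm (G → ℤ)) p k - p k| ≤ m

variable {φ p : G → ℤ} {v w : Coprod G (FreeGroup Unit)} {m n : ℕ}

theorem DisplacesLE.one : DisplacesLE φ p 1 0 := by simp [DisplacesLE]

theorem DisplacesLE.inv (h : DisplacesLE φ p w m) : DisplacesLE φ p w⁻¹ m := by
  intro k
  rw [abs_sub_comm]
  refine ((affineHom φ w).2 p _ m).mp (fun k => ?_) k
  simpa using h k

theorem DisplacesLE.mul (hv : DisplacesLE φ p v m) (hw : DisplacesLE φ p w n) :
    DisplacesLE φ p (v * w) (m + n) := by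
  intro k
  have h1 := ((affineHom φ v).2 _ p n).mpr hw k
  have h2 := hv k
  simp only [map_mul, Subgroup.coe_mul, Equiv.Perm.mul_apply, Nat.cast_add]
  rw [abs_le] at *
  constructor <;> linarith [h1.1, h1.2, h2.1, h2.2]

theorem IsLengthFun.displacesLE_inl_iff {ℓ : G → ℕ} (hℓ : IsLengthFun ℓ) (φ : G → ℤ) (g : G) :
    DisplacesLE φ (fun k => (ℓ k : ℤ)) (Coprod.inl g) m ↔ ℓ g ≤ m := by
  simp only [DisplacesLE, affineHom, Coprod.lift_apply_inl, shiftHom_apply]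
  constructor
  · intro h
    have := h 1
    rw [mul_one, hℓ.2.1, (hℓ.1 1).mpr rfl] at this
    simpa using this
  · intro h k
    have h1 := hℓ.2.2 g⁻¹ k
    have h2 := hℓ.2.2 g (g⁻¹ * k)
    rw [hℓ.2.1] at h1
    rw [mul_inv_cancel_left] at h2
    rw [abs_le]
    constructor <;> omega

/-- An element of length `n + 2` splits, after adjoining a free generator, as a product of factors
of lengths `1` and `n + 1`, without changing the lengths of the elements of the group. -/
theorem IsLengthFun.exists_displacesLE {ℓ : G → ℕ} (hℓ : IsLengthFun ℓ) {g : G} {n : ℕ}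
    (hg : ℓ g = n + 1) : ∃ φ : G → ℤ,
      DisplacesLE φ (fun k => (ℓ k : ℤ)) (Coprod.inr (FreeGroup.of ())) 1 ∧
      DisplacesLE φ (fun k => (ℓ k : ℤ)) ((Coprod.inr (FreeGroup.of ()))⁻¹ * Coprod.inl g) n := by
  let φ : G → ℤ := fun k => max (-1) (min 1 ((ℓ (g⁻¹ * k) : ℤ) - ℓ k))
  refine ⟨φ, fun k => ?_, fun k => ?_⟩
  · simp only [affineHom, Coprod.lift_apply_inr, FreeGroup.lift_apply_of,
      addIsometry_apply, φ]
    rw [abs_le]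
    omega
  · have h := (hℓ.displacesLE_inl_iff φ g).mpr hg.le k
    simp only [affineHom, Coprod.lift_apply_inl, shiftHom_apply] at h
    simp only [affineHom, map_mul, map_inv, Coprod.lift_apply_inr, Coprod.lift_apply_inl,
      FreeGroup.lift_apply_of, addIsometry_inv, Subgroup.coe_mul,
      Equiv.Perm.mul_apply, addIsometry_apply, shiftHom_apply, Pi.neg_apply, φ]
    rw [abs_le] at *
    omega

end Isometries

section WeightLength

variable {G : Type*} [Group G]

theorem exists_word_weightLength (ω : G → ℕ) (g : G) :
    ∃ w : List (G × Bool), (w.map fun p => ω p.1).sum = weightLength ω g ∧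
      (w.map fun p => if p.2 then p.1 else p.1⁻¹).prod = g :=
  Nat.sInf_mem (s := {N | ∃ w : List (G × Bool), (w.map fun p => ω p.1).sum = N ∧
    (w.map fun p => if p.2 then p.1 else p.1⁻¹).prod = g}) ⟨ω g, [(g, true)], by simp, by simp⟩

theorem weightLength_le_sum (ω : G → ℕ) (w : List (G × Bool)) :
    weightLength ω (w.map fun p => if p.2 then p.1 else p.1⁻¹).prod ≤
      (w.map fun p => ω p.1).sum :=
  Nat.sInf_le ⟨w, rfl, rfl⟩

theorem weightLength_le (ω : G → ℕ) (g : G) : weightLength ω g ≤ ω g := by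
  simpa using weightLength_le_sum ω [(g, true)]

theorem weightLength_inv_le (ω : G → ℕ) (g : G) : weightLength ω g⁻¹ ≤ weightLength ω g := by
  obtain ⟨w, hw, rfl⟩ := exists_word_weightLength ω g
  rw [← hw]
  convert weightLength_le_sum ω (w.map fun p => (p.1, !p.2)).reverse using 1
  · congr 1
    rw [List.prod_inv_reverse, List.map_reverse, List.map_map, List.map_map]
    congr 3
    funext p
    rcases p with ⟨x, _ | _⟩ <;> simp
  · rw [List.map_reverse, List.sum_reverse, List.map_map]
    rfl

theorem isLengthFun_weightLength {ω : G → ℕ} (hω : ∀ g, 1 ≤ ω g) :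
    IsLengthFun (weightLength ω) := by
  refine ⟨fun g => ⟨fun h => ?_, ?_⟩, fun g => le_antisymm (weightLength_inv_le ω g) ?_,
    fun g h => ?_⟩
  · obtain ⟨w, hw, rfl⟩ := exists_word_weightLength ω g
    cases w with
    | nil => rfl
    | cons p w =>
      have := hω p.1
      simp only [List.map_cons, List.sum_cons] at hw h
      omega
  · rintro rfl
    simpa using weightLength_le_sum ω []
  · simpa using weightLength_inv_le ω g⁻¹
  · obtain ⟨v, hv, hvg⟩ := exists_word_weightLength ω g
    obtain ⟨w, hw, hwh⟩ := exists_word_weightLength ω h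
    simpa [hv, hw, hvg, hwh] using weightLength_le_sum ω (v ++ w)

theorem length_le_sum_of_one_le {α : Type*} {ω : α → ℕ} (hω : ∀ a, 1 ≤ ω a) (l : List α) :
    l.length ≤ (l.map ω).sum := by
  simpa using List.card_nsmul_le_sum (l.map ω) 1 (by simpa using fun a _ => hω a)

end WeightLength

section WordLength

variable {G : Type*} [Group G]

/-- A length function is a word length if every element of length at least two splits off a factor
of length one geodesically. -/
theorem IsLengthFun.isWordLength {ℓ : G → ℕ} (hℓ : IsLengthFun ℓ)
    (h : ∀ g, 2 ≤ ℓ g → ∃ a, ℓ a = 1 ∧ ℓ (a⁻¹ * g) + 1 = ℓ g) : IsWordLength ℓ := by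
  have word : ∀ (n : ℕ) (g : G), ℓ g = n → ∃ w : List G, w.length = n ∧
      (∀ x ∈ w, x ∈ {x | ℓ x = 1} ∨ x⁻¹ ∈ {x | ℓ x = 1}) ∧ w.prod = g := by
    intro n
    induction n with
    | zero => exact fun g hg => ⟨[], rfl, by simp, by simp [(hℓ.1 g).mp hg]⟩
    | succ n ih =>
      intro g hg
      rcases Nat.eq_zero_or_pos n with rfl | hn
      · exact ⟨[g], rfl, by simp [hg], by simp⟩
      · obtain ⟨a, ha, hag⟩ := h g (by omega)
        obtain ⟨w, hwl, hw, hwp⟩ := ih (a⁻¹ * g) (by omega)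
        refine ⟨a :: w, by simp [hwl], ?_, by simp [hwp]⟩
        intro x hx
        rcases List.mem_cons.mp hx with rfl | hx
        · exact Or.inl ha
        · exact hw x hx
  have le_length : ∀ w : List G, (∀ x ∈ w, x ∈ {x | ℓ x = 1} ∨ x⁻¹ ∈ {x | ℓ x = 1}) →
      ℓ w.prod ≤ w.length := by
    intro w hw
    induction w with
    | nil => simp [(hℓ.1 1).mpr rfl]
    | cons a w ih =>
      have h1 := ih fun x hx => hw x (List.mem_cons_of_mem _ hx)
      have h2 := hℓ.2.2 a w.prod
      have h3 : ℓ a = 1 := by simpa [hℓ.2.1] using hw a List.mem_cons_self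
      simp only [List.prod_cons, List.length_cons]
      omega
  refine ⟨{x | ℓ x = 1}, ?_, fun g => ?_⟩
  · rw [Subgroup.eq_top_iff']
    intro g
    obtain ⟨w, -, hw, rfl⟩ := word _ g rfl
    refine Subgroup.list_prod_mem _ fun x hx => ?_
    rcases hw x hx with h | h
    · exact Subgroup.subset_closure h
    · exact inv_mem_iff.mp (Subgroup.subset_closure h)
  · obtain ⟨v, hv⟩ := word _ g rfl
    refine le_antisymm (le_csInf ⟨_, v, hv⟩ ?_) (Nat.sInf_le ⟨v, hv⟩)
    rintro _ ⟨w, rfl, hw, rfl⟩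
    exact le_length w hw

end WordLength

section Genericity

open Monoid

variable {G : Type*} [Group G]

/-- If every letter of small weight lifts to an element of `T` with displacement bounded by its
weight, then so do words of small weight. -/
theorem exists_lift_word {φ p : G → ℤ} {h : G} {ω : G → ℕ} {N : ℕ}
    {T : Set (Coprod G (FreeGroup Unit))}
    (hT : ∀ y, ω y < N → ∃ t ∈ T, evalAt h t = y ∧ DisplacesLE φ p t (ω y))
    (w : List (G × Bool)) (hw : (w.map fun q => ω q.1).sum < N) :
    ∃ W ∈ (T ∪ T⁻¹) ^ w.length,
      evalAt h W = (w.map fun q => if q.2 then q.1 else q.1⁻¹).prod ∧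
      DisplacesLE φ p W (w.map fun q => ω q.1).sum := by
  induction w with
  | nil => exact ⟨1, by simp, by simp, DisplacesLE.one⟩
  | cons q w ih =>
    simp only [List.map_cons, List.sum_cons] at hw
    obtain ⟨W, hWT, hWe, hWd⟩ := ih (by omega)
    obtain ⟨t, htT, hte, htd⟩ := hT q.1 (by omega)
    simp only [List.map_cons, List.sum_cons, List.prod_cons, List.length_cons, pow_succ']
    rcases q with ⟨y, _ | _⟩
    · exact ⟨t⁻¹ * W, Set.mul_mem_mul (Or.inr (Set.inv_mem_inv.mpr htT)) hWT,
        by simp [hte, hWe], htd.inv.mul hWd⟩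
    · exact ⟨t * W, Set.mul_mem_mul (Or.inl htT) hWT, by simp [hte, hWe], htd.mul hWd⟩

theorem Set.Finite.pow_pointwise {M : Type*} [Monoid M] {s : Set M} (hs : s.Finite) (n : ℕ) :
    (s ^ n).Finite := by
  induction n with
  | zero => simp
  | succ n ih => exact pow_succ s n ▸ ih.mul hs

/-- In an MIF group, the values of a length function on a finite set can be kept while making
a given element split off a factor of length one geodesically. -/
theorem MIF.exists_isLengthFun_split (hG : MIF G) {ℓ : G → ℕ} (hℓ : IsLengthFun ℓ)
    (F : Finset G) {g : G} (hg : 2 ≤ ℓ g) :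
    ∃ ℓ' : G → ℕ, IsLengthFun ℓ' ∧ (∀ f ∈ F, ℓ' f = ℓ f) ∧ ℓ' g = ℓ g ∧
      ∃ a, ℓ' a = 1 ∧ ℓ' (a⁻¹ * g) + 1 = ℓ' g := by
  classical
  obtain ⟨n, hn⟩ : ∃ n, ℓ g = n + 1 := ⟨ℓ g - 1, by omega⟩
  have hg1 : g ≠ 1 := fun h => by
    have := (hℓ.1 g).mpr h
    omega
  let E : Finset G := insert g (F.erase 1)
  have hgE : g ∈ E := Finset.mem_insert_self _ _
  have hE1 : ∀ f ∈ E, 1 ≤ ℓ f := by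
    intro f hf
    refine Nat.one_le_iff_ne_zero.mpr fun h0 => ?_
    obtain rfl := (hℓ.1 f).mp h0
    simp [E, hg1.symm] at hf
  obtain ⟨N, hN⟩ : ∃ N, ∀ f ∈ E, ℓ f < N :=
    ⟨E.sup ℓ + 1, fun f hf => Nat.lt_succ_of_le (Finset.le_sup hf)⟩
  have hnN := hN g hgE
  obtain ⟨φ, hx, hy⟩ := hℓ.exists_displacesLE hn
  let x : Coprod G (FreeGroup Unit) := Coprod.inr (FreeGroup.of ())
  let T : Set (Coprod G (FreeGroup Unit)) := {1, x, x⁻¹ * Coprod.inl g} ∪ Coprod.inl '' (E : Set G)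
  have hTfin : T.Finite := (Set.toFinite _).union (E.finite_toSet.image _)
  let B : Set (Coprod G (FreeGroup Unit)) :=
    (((Coprod.inl '' (E : Set G))⁻¹ * (T ∪ T⁻¹) ^ N : Set (Coprod G (FreeGroup Unit)))) \ {1}
  have hBfin : B.Finite := by
    refine Set.Finite.sdiff (Set.Finite.mul (E.finite_toSet.image _).inv ?_)
    exact (hTfin.union hTfin.inv).pow_pointwise N
  obtain ⟨h, hh⟩ := hG.exists_forall_evalAt_ne_one hBfin fun w hw => hw.2
  let ω : G → ℕ := fun y => min (if y ∈ E then ℓ y else N)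
    (min (if y = h then 1 else N) (if y = h⁻¹ * g then n else N))
  have hω : ∀ y, 1 ≤ ω y := by
    intro y
    refine le_min ?_ (le_min ?_ ?_)
    · split_ifs with hy
      exacts [hE1 y hy, by omega]
    · split_ifs <;> omega
    · split_ifs <;> omega
  have hlift : ∀ y, ω y < N → ∃ t ∈ T, evalAt h t = y ∧
      DisplacesLE φ (fun k => (ℓ k : ℤ)) t (ω y) := by
    intro y hyN
    have weight_cases : ω y = N ∨ (y ∈ E ∧ ω y = ℓ y) ∨ (y = h ∧ ω y = 1) ∨
        (y = h⁻¹ * g ∧ ω y = n) := by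
      simp only [ω]
      grind
    rcases weight_cases with h0 | ⟨hyE, h0⟩ | ⟨rfl, h0⟩ | ⟨rfl, h0⟩
    · omega
    · exact ⟨Coprod.inl y, Or.inr ⟨y, hyE, rfl⟩, by simp,
        (hℓ.displacesLE_inl_iff φ y).mpr h0.ge⟩
    · exact ⟨x, Or.inl (by simp), by simp [x], h0 ▸ hx⟩
    · exact ⟨x⁻¹ * Coprod.inl g, Or.inl (by simp), by simp [x], h0 ▸ hy⟩
  have hlen := isLengthFun_weightLength hω
  have heq : ∀ f ∈ E, weightLength ω f = ℓ f := by
    intro f hf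
    have hle : weightLength ω f ≤ ℓ f := by
      refine (weightLength_le ω f).trans ((min_le_left _ _).trans ?_)
      simp [hf]
    refine le_antisymm hle ?_
    have hfN := hN f hf
    obtain ⟨w, hw, hwf⟩ := exists_word_weightLength ω f
    obtain ⟨W, hWT, hWe, hWd⟩ := exists_lift_word hlift w (by omega)
    have hWN : W ∈ (T ∪ T⁻¹) ^ N := by
      have hT1 : 1 ∈ T ∪ T⁻¹ := Or.inl (Or.inl (by simp))
      refine Set.pow_subset_pow_right hT1 ?_ hWT
      have := length_le_sum_of_one_le (ω := fun q : G × Bool => ω q.1) (fun q => hω q.1) w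
      omega
    have hWf : (Coprod.inl f)⁻¹ * W = 1 := by
      by_contra hne
      refine hh _ ⟨Set.mul_mem_mul (Set.inv_mem_inv.mpr ⟨f, hf, rfl⟩) hWN, hne⟩ ?_
      simp [hWe, hwf]
    have hWf' : Coprod.inl f = W := inv_mul_eq_one.mp hWf
    rw [← hWf', hw] at hWd
    exact (hℓ.displacesLE_inl_iff φ f).mp hWd
  have hgeq := heq g hgE
  have hh1 : weightLength ω h ≤ 1 := by
    refine (weightLength_le ω h).trans ((min_le_right _ _).trans ((min_le_left _ _).trans ?_))
    simp
  have hhn : weightLength ω (h⁻¹ * g) ≤ n := by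
    refine (weightLength_le ω _).trans ((min_le_right _ _).trans ((min_le_right _ _).trans ?_))
    simp
  have htri := hlen.2.2 h (h⁻¹ * g)
  rw [mul_inv_cancel_left] at htri
  refine ⟨weightLength ω, hlen, fun f hf => ?_, hgeq, h, by omega, by omega⟩
  by_cases hf1 : f = 1
  · rw [(hlen.1 f).mpr hf1, (hℓ.1 f).mpr hf1]
  · exact heq f (by simp [E, hf, hf1])

/-- The length functions for which `g` has length at most one or splits off a factor of length one
geodesically. -/
def splitSet (g : G) : Set (LengthFun G) :=
  {ℓ | 2 ≤ ℓ.1 g → ∃ a, ℓ.1 a = 1 ∧ ℓ.1 (a⁻¹ * g) + 1 = ℓ.1 g}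

theorem isOpen_splitSet (g : G) : IsOpen (splitSet g) := by
  have hc : ∀ a : G, Continuous fun ℓ : LengthFun G => ℓ.1 a := fun a =>
    (continuous_apply a).comp continuous_subtype_val
  have : splitSet g = {ℓ : LengthFun G | ℓ.1 g < 2} ∪
      ⋃ a, {ℓ : LengthFun G | ℓ.1 a = 1} ∩ {ℓ : LengthFun G | ℓ.1 (a⁻¹ * g) + 1 = ℓ.1 g} := by
    ext ℓ
    simp only [splitSet, Set.mem_ofPred_eq, Set.mem_union, Set.mem_iUnion, Set.mem_inter_iff]
    rw [← not_le, imp_iff_not_or]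
  rw [this]
  refine IsOpen.union ?_ (isOpen_iUnion fun a => IsOpen.inter ?_ ?_)
  · exact (isOpen_discrete {m | m < 2}).preimage (hc g)
  · exact (isOpen_discrete {1}).preimage (hc a)
  · exact (isOpen_discrete {q : ℕ × ℕ | q.1 + 1 = q.2}).preimage ((hc (a⁻¹ * g)).prodMk (hc g))

theorem MIF.dense_splitSet (hG : MIF G) (g : G) : Dense (splitSet g) := by
  intro ℓ
  rw [mem_closure_iff_nhds]
  intro V hV
  by_cases hg : 2 ≤ ℓ.1 g
  · rw [nhds_subtype_eq_comap, Filter.mem_comap] at hV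
    obtain ⟨U, hU, hUV⟩ := hV
    rw [nhds_pi, Filter.mem_pi] at hU
    obtain ⟨I, hI, t, ht, htU⟩ := hU
    obtain ⟨ℓ', hℓ', hF, -, ha⟩ := hG.exists_isLengthFun_split ℓ.2 hI.toFinset hg
    refine ⟨⟨ℓ', hℓ'⟩, hUV (htU fun i hi => ?_), fun _ => ha⟩
    change ℓ' i ∈ t i
    rw [hF i (hI.mem_toFinset.mpr hi)]
    exact mem_of_mem_nhds (ht i)
  · exact ⟨ℓ, mem_of_mem_nhds hV, fun h => absurd h hg⟩

end Genericity

theorem stmt1 (G : Type) [Group G] [Countable G] (hG : MIF G) :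
    {ℓ : LengthFun G | IsWordLength ℓ.1} ∈ residual (LengthFun G) := by
  have h : (⋂ g : G, splitSet g) ∈ residual (LengthFun G) :=
    countable_iInter_mem.mpr fun g => residual_of_dense_open (isOpen_splitSet g)
      (hG.dense_splitSet g)
  exact Filter.mem_of_superset h fun ℓ hℓ => ℓ.2.isWordLength fun g => Set.mem_iInter.mp hℓ g
end

section
/- Every countable MIF group G has an unbounded Cayley graph; that is, there exists a generating set X of G such that the word length with respect to X is unbounded on G. -/
open Set Function Pointwise

/-- Mixed words over `G` in one variable. -/
abbrev MixedWord (G : Type*) [Group G] : Type _ := Monoid.Coprod G (FreeGroup Unit)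

namespace MixedWord

open Monoid

variable {G K : Type*} [Group G] [Group K]

/-- The variable of `MixedWord G`. -/
def var : MixedWord G := Coprod.inr (FreeGroup.of ())

/-- Interpret the constants of a mixed word through `f` and its variable as `k`. -/
def eval (f : G →* K) (k : K) : MixedWord G →* K :=
  Coprod.lift f (FreeGroup.lift fun _ => k)

@[simp] lemma eval_inl (f : G →* K) (k : K) (g : G) : eval f k (Coprod.inl g) = f g := by
  simp [eval]

@[simp] lemma eval_var (f : G →* K) (k : K) : eval f k var = k := by
  simp [eval, var]

lemma hom_ext {φ ψ : MixedWord G →* K} (hc : ∀ g, φ (Coprod.inl g) = ψ (Coprod.inl g))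
    (hv : φ var = ψ var) : φ = ψ :=
  Coprod.hom_ext (MonoidHom.ext hc) (FreeGroup.ext_hom _ _ fun _ => hv)

@[elab_as_elim]
lemma induction {p : MixedWord G → Prop} (w : MixedWord G) (inl : ∀ g, p (Coprod.inl g))
    (var : p var) (mul : ∀ v w, p v → p w → p (v * w)) (inv : ∀ v, p v → p v⁻¹) : p w := by
  induction w using Coprod.induction_on with
  | inl g => exact inl g
  | inr n =>
    induction n using FreeGroup.induction_on with
    | C1 => simpa using inl 1
    | of x => exact var
    | inv_of x h => simpa using inv _ h
    | mul x y hx hy => simpa using mul _ _ hx hy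
  | mul x y hx hy => exact mul x y hx hy

lemma var_mul_inl_ne_one (g : G) : (var * Coprod.inl g : MixedWord G) ≠ 1 := by
  intro h
  have := congrArg Coprod.snd h
  simp [var] at this

/-- The substitution replacing the variable `x` by `x c x`. -/
def thicken (c : G) : MixedWord G →* MixedWord G :=
  eval Coprod.inl (var * Coprod.inl c * var)

lemma eval_thicken (c : G) (f : G →* K) (k : K) (w : MixedWord G) :
    eval f k (thicken c w) = eval f (k * f c * k) w := by
  have : (eval f k).comp (thicken c) = eval f (k * f c * k) :=
    hom_ext (by simp [thicken]) (by simp [thicken])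
  exact DFunLike.congr_fun this w

section Emulation

variable {Z : Type*}

open Classical in
/-- A permutation of an extension of `Z` which, together with left multiplication by `c` on the
`G`-coordinates, encodes the permutations `a` and `b` of `Z`: its nontrivial
cycles are `z, (true, z, 1), (false, z, 1), (false, b⁻¹ z, c), (true, a⁻¹ z, c)` for `z` in `Z`. -/
noncomputable def encodingPerm {c : G} (hc : c ≠ 1) (a b : Equiv.Perm Z) :
    Equiv.Perm (Z ⊕ Bool × Z × G) where
  toFun
    | .inl z => .inr (true, z, 1)
    | .inr (true, z, h) =>
      if h = 1 then .inr (false, z, 1) else if h = c then .inl (a z) else .inr (true, z, h)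
    | .inr (false, z, h) =>
      if h = 1 then .inr (false, b⁻¹ z, c) else
      if h = c then .inr (true, a⁻¹ (b z), c) else .inr (false, z, h)
  invFun
    | .inl z => .inr (true, a⁻¹ z, c)
    | .inr (true, z, h) =>
      if h = 1 then .inl z else if h = c then .inr (false, b⁻¹ (a z), c) else .inr (true, z, h)
    | .inr (false, z, h) =>
      if h = 1 then .inr (true, z, 1) else
      if h = c then .inr (false, b z, 1) else .inr (false, z, h)
  left_inv := by
    rintro (z | ⟨_ | _, z, h⟩)
    · simp
    all_goals
      by_cases h1 : h = 1
      · simp [h1, hc]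
      · by_cases h2 : h = c <;> simp [h1, h2, hc]
  right_inv := by
    rintro (z | ⟨_ | _, z, h⟩)
    · simp [hc]
    all_goals
      by_cases h1 : h = 1
      · simp [h1]
      · by_cases h2 : h = c <;> simp [h1, h2, hc]

/-- The extension of an action of `G` on `Z` by left multiplication on `G`-coordinates. -/
def extendedAction (ρ : G →* Equiv.Perm Z) : G →* Equiv.Perm (Z ⊕ Bool × Z × G) where
  toFun g := Equiv.sumCongr (ρ g)
    (Equiv.prodCongr (Equiv.refl _) (Equiv.prodCongr (Equiv.refl _) (Equiv.mulLeft g)))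
  map_one' := by ext (z | ⟨i, z, h⟩) <;> simp
  map_mul' g g' := by ext (z | ⟨i, z, h⟩) <;> simp [mul_assoc]

lemma eval_thicken_encodingPerm {c : G} (hc : c ≠ 1) (ρ : G →* Equiv.Perm Z)
    (a b : Equiv.Perm Z) (w : MixedWord G) (z : Z) :
    eval (extendedAction ρ) (encodingPerm hc a b) (thicken c w) (.inl z) =
      .inl (eval ρ a w z) := by
  induction w using MixedWord.induction generalizing z with
  | inl g => simp [thicken, extendedAction]
  | var => simp [thicken, extendedAction, encodingPerm, hc]
  | mul v w hv hw => simp [hv, hw]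
  | inv v hv => rw [map_inv, map_inv, map_inv, Equiv.Perm.inv_eq_iff_eq, hv]; simp

lemma eval_conjugator_encodingPerm {c : G} (hc : c ≠ 1) (ρ : G →* Equiv.Perm Z)
    (a b : Equiv.Perm Z) (z : Z) :
    eval (extendedAction ρ) (encodingPerm hc a b)
      (var * var * Coprod.inl c * (var * var)) (.inl z) = .inl (b z) := by
  simp [extendedAction, encodingPerm, hc]

end Emulation

open Classical in
/-- Nontrivial elements of a group can be made non-commuting by conjugating one of them with a
permutation of the group and an additional point. -/
lemma exists_perm_not_commute {H : Type*} [Group H] {v w : H} (hv : v ≠ 1) (hw : w ≠ 1) :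
    ∃ (ρ : H →* Equiv.Perm (Option H)) (u : Equiv.Perm (Option H)),
      ρ v * (u * ρ w * u⁻¹) ≠ u * ρ w * u⁻¹ * ρ v := by
  let ρ : H →* Equiv.Perm (Option H) :=
    { toFun := fun h => Equiv.optionCongr (Equiv.mulLeft h)
      map_one' := by ext (_ | z) <;> simp
      map_mul' := fun h h' => by ext (_ | z) <;> simp [mul_assoc] }
  let u : Equiv.Perm (Option H) := Equiv.swap none (some v) * Equiv.swap none (some 1)
  have hu1 : u none = some 1 := by
    simp only [u, Equiv.Perm.mul_apply, Equiv.swap_apply_left]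
    exact Equiv.swap_apply_of_ne_of_ne (by simp) (by simpa using hv.symm)
  have hu2 : u (some 1) = some v := by simp [u]
  have hu3 : u⁻¹ (some 1) = none := by rw [Equiv.Perm.inv_eq_iff_eq, hu1]
  have hu4 : u⁻¹ (some v) = some 1 := by rw [Equiv.Perm.inv_eq_iff_eq, hu2]
  refine ⟨ρ, u, fun h => hw ?_⟩
  have hρ : ∀ x y, ρ x (some y) = some (x * y) := fun x y => by simp [ρ]
  have hρn : ∀ x, ρ x none = none := fun x => by simp [ρ]
  have key := DFunLike.congr_fun h (some 1)
  simp only [Equiv.Perm.mul_apply, hu3, hρn, hu1, hρ, mul_one, hu4] at key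
  rw [← hu2] at key
  simpa using (u.injective key).symm

lemma commutator_thicken_ne_one {c : G} (hc : c ≠ 1) {v w : MixedWord G} (hv : v ≠ 1)
    (hw : w ≠ 1) : ∃ u : MixedWord G, thicken c v * (u * thicken c w * u⁻¹) ≠
      u * thicken c w * u⁻¹ * thicken c v := by
  obtain ⟨ρ, b, h⟩ := exists_perm_not_commute hv hw
  refine ⟨var * var * Coprod.inl c * (var * var), fun h' => h ?_⟩
  have hev : ∀ t, eval (ρ.comp Coprod.inl) (ρ var) t = ρ t := fun t =>
    DFunLike.congr_fun (hom_ext (φ := eval (ρ.comp Coprod.inl) (ρ var)) (by simp) (by simp)) t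
  set Φ := eval (extendedAction (ρ.comp Coprod.inl)) (encodingPerm hc (ρ var) b) with hΦ
  have hΦt : ∀ t z, Φ (thicken c t) (.inl z) = .inl (ρ t z) := fun t z => by
    rw [hΦ, eval_thicken_encodingPerm, hev]
  have hΦu := eval_conjugator_encodingPerm hc (ρ.comp Coprod.inl) (ρ var) b
  rw [← hΦ] at hΦu
  have hΦu' : ∀ z, (Φ (var * var * Coprod.inl c * (var * var)))⁻¹ (.inl z) = .inl (b⁻¹ z) :=
    fun z => by rw [Equiv.Perm.inv_eq_iff_eq, hΦu]; simp
  ext1 z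
  have key := DFunLike.congr_fun (congrArg Φ h') (.inl z)
  rw [map_mul Φ, map_mul Φ _ (_⁻¹), map_mul Φ _ (thicken c w), map_mul Φ _ (thicken c v),
    map_mul Φ _ (_⁻¹), map_mul Φ _ (thicken c w), map_inv] at key
  simp only [Equiv.Perm.mul_apply, hΦt, hΦu, hΦu'] at key
  simpa using key

lemma thicken_ne_one {c : G} (hc : c ≠ 1) {w : MixedWord G} (hw : w ≠ 1) : thicken c w ≠ 1 := by
  obtain ⟨u, h⟩ := commutator_thicken_ne_one hc hw hw
  intro h'
  simp [h'] at h

end MixedWord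

open MixedWord Monoid

section

variable {G : Type*} [Group G]

lemma MIF.exists_ne_one (hG : MIF G) : ∃ c : G, c ≠ 1 := by
  obtain ⟨c, hc⟩ := hG (var * Coprod.inl 1) (var_mul_inl_ne_one 1)
  exact ⟨c, by simpa [var] using hc⟩

/-- Finitely many nontrivial mixed words over an MIF group have a common non-root. -/
lemma MIF.exists_forall_eval_ne_one (hG : MIF G) (L : List (MixedWord G))
    (hL : ∀ w ∈ L, w ≠ 1) : ∃ g : G, ∀ w ∈ L, eval (MonoidHom.id G) g w ≠ 1 := by
  obtain ⟨c, hc⟩ := hG.exists_ne_one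
  match L with
  | [] => exact ⟨1, by simp⟩
  | [w] =>
    obtain ⟨g, hg⟩ := hG w (hL w (by simp))
    exact ⟨g, by simpa [MixedWord.eval] using hg⟩
  | v :: w :: L =>
    simp only [List.mem_cons, forall_eq_or_imp] at hL
    obtain ⟨hv, hw, hL⟩ := hL
    obtain ⟨u, hu⟩ := commutator_thicken_ne_one hc hv hw
    obtain ⟨g, hg⟩ := hG.exists_forall_eval_ne_one
      ((thicken c v * (u * thicken c w * u⁻¹)) * (u * thicken c w * u⁻¹ * thicken c v)⁻¹ ::
        L.map (thicken c)) (by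
        simp only [List.mem_cons, forall_eq_or_imp, List.forall_mem_map]
        exact ⟨fun h => hu (mul_inv_eq_one.1 h), fun t ht => thicken_ne_one hc (hL t ht)⟩)
    simp only [List.mem_cons, forall_eq_or_imp, List.forall_mem_map, eval_thicken, map_mul,
      map_inv] at hg
    refine ⟨g * MonoidHom.id G c * g, ?_⟩
    simp only [List.mem_cons, forall_eq_or_imp]
    exact ⟨fun h => hg.1 (by simp only [h]; group), fun h => hg.1 (by simp only [h]; group), hg.2⟩
termination_by L.length

lemma MIF.exists_forall_finite (hG : MIF G) {S : Set (MixedWord G)} (hS : S.Finite)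
    (h1 : 1 ∉ S) : ∃ g : G, ∀ w ∈ S, eval (MonoidHom.id G) g w ≠ 1 := by
  obtain ⟨g, hg⟩ := hG.exists_forall_eval_ne_one hS.toFinset.toList
    (fun w hw h => h1 (by simpa [h] using hw))
  exact ⟨g, fun w hw => hg w (by simpa using hw)⟩

/-- The elements that are products of at most `k` elements of `X` and their inverses. -/
def wordBall (X : Set G) (k : ℕ) : Set G := (insert 1 (X ∪ X⁻¹)) ^ k

lemma finite_wordBall {X : Set G} (hX : X.Finite) (k : ℕ) : (wordBall X k).Finite := by
  rw [wordBall]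
  induction k with
  | zero => simp
  | succ k ih => exact pow_succ (insert 1 (X ∪ X⁻¹)) k ▸ ih.mul ((hX.union hX.inv).insert 1)

lemma image_wordBall {K : Type*} [Group K] (f : G →* K) (X : Set G) (k : ℕ) :
    f '' wordBall X k = wordBall (f '' X) k := by
  rw [wordBall, wordBall, Set.image_pow, image_insert_eq, image_union, map_one, Set.image_inv]

lemma mul_mem_wordBall_succ {X : Set G} {k : ℕ} {x g : G} (hx : x ∈ insert 1 (X ∪ X⁻¹))
    (hg : g ∈ wordBall X k) : x * g ∈ wordBall X (k + 1) := by
  rw [wordBall, pow_succ']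
  exact mul_mem_mul hx hg

lemma wordBall_subset_succ (X : Set G) (k : ℕ) : wordBall X k ⊆ wordBall X (k + 1) :=
  fun g hg => by simpa using mul_mem_wordBall_succ (mem_insert 1 _) hg

lemma prod_mem_wordBall {X : Set G} {k : ℕ} {l : List G} (hl : ∀ x ∈ l, x ∈ X ∨ x⁻¹ ∈ X)
    (hk : l.length ≤ k) : l.prod ∈ wordBall X k := by
  have : l.prod ∈ wordBall X l.length := by
    clear hk
    induction l with
    | nil => simp [wordBall]
    | cons x l ih =>
      simp only [List.mem_cons, forall_eq_or_imp] at hl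
      rw [List.prod_cons, List.length_cons]
      exact mul_mem_wordBall_succ (.inr (by simpa using hl.1)) (ih hl.2)
  exact monotone_nat_of_le_succ (wordBall_subset_succ X) hk this

lemma exists_list_of_closure_eq_top {X : Set G} (hX : Subgroup.closure X = ⊤) (g : G) :
    ∃ l : List G, l.length = wordLength X g ∧ (∀ x ∈ l, x ∈ X ∨ x⁻¹ ∈ X) ∧ l.prod = g := by
  have hg : g ∈ Subgroup.closure X := hX ▸ Subgroup.mem_top g
  rw [← Subgroup.mem_toSubmonoid, Subgroup.closure_toSubmonoid] at hg
  obtain ⟨l, hl, hlg⟩ := Submonoid.exists_list_of_mem_closure hg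
  exact Nat.sInf_mem (s := {n : ℕ | ∃ w : List G, w.length = n ∧ (∀ x ∈ w, x ∈ X ∨ x⁻¹ ∈ X) ∧
    w.prod = g}) ⟨_, l, rfl, hl, hlg⟩

/-- The generators `X` together with a variable `x` and `x ^ m * g`, which make `g` a product of
`m + 1` generators and their inverses in a generic way. -/
def genericGenerators (X : Set G) (g : G) (m : ℕ) : Set (MixedWord G) :=
  insert var (insert (var ^ m * Coprod.inl g) (Coprod.inl '' X))

section BlockAction

variable (g : G) (m : ℕ)

/-- The action of `G` on `G × ℤ` by left multiplication on the first `m` levels, conjugated by a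
further power of `g` on each further block of `m` levels. -/
def blockAction : G →* Equiv.Perm (G × ℤ) where
  toFun a :=
    { toFun := fun p => (g ^ (p.2 / m) * a * (g ^ (p.2 / m))⁻¹ * p.1, p.2)
      invFun := fun p => (g ^ (p.2 / m) * a⁻¹ * (g ^ (p.2 / m))⁻¹ * p.1, p.2)
      left_inv := fun p => Prod.ext (by simp [mul_assoc]) rfl
      right_inv := fun p => Prod.ext (by simp [mul_assoc]) rfl }
  map_one' := by ext p <;> simp
  map_mul' a b := by ext p <;> simp [mul_assoc]

/-- The action of mixed words on `G × ℤ` in which the variable acts as the unit shift. -/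
def blockEval : MixedWord G →* Equiv.Perm (G × ℤ) :=
  eval (blockAction g m) (Equiv.prodCongr (Equiv.refl G) (Equiv.addRight 1))

lemma blockEval_inl (a h : G) (i : ℤ) : blockEval g m (Coprod.inl a) (h, i) =
    (g ^ (i / m) * a * (g ^ (i / m))⁻¹ * h, i) := by
  simp [blockEval, blockAction]

lemma blockEval_var (h : G) (i : ℤ) : blockEval g m var (h, i) = (h, i + 1) := by
  simp [blockEval]

lemma blockEval_var_pow (n : ℕ) (h : G) (i : ℤ) :
    blockEval g m (var ^ n) (h, i) = (h, i + n) := by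
  induction n with
  | zero => simp
  | succ n ih => rw [pow_succ', map_mul, Equiv.Perm.mul_apply, ih, blockEval_var]; simp [add_assoc]

variable {g m}

lemma exists_blockEval_eq {X : Set G} {K j : ℕ} (hj : j ≤ K) (hm : 2 * K < m) {w : MixedWord G}
    (hw : w ∈ wordBall (genericGenerators X g m) j) :
    ∃ v ∈ wordBall X j, ∃ i q : ℤ, |i - K| ≤ j ∧
      blockEval g m w (1, (K : ℤ)) = (g ^ q * v, i + q * m) := by
  induction j generalizing w with
  | zero =>
    obtain rfl : w = 1 := by simpa [wordBall] using hw
    exact ⟨1, by simp [wordBall], K, 0, by simp, by simp⟩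
  | succ j ih =>
    rw [wordBall, pow_succ'] at hw
    obtain ⟨s, hs, w, hw, rfl⟩ := hw
    obtain ⟨v, hv, i, q, hi, hvw⟩ := ih (by omega) hw
    have hi' := abs_le.1 hi
    have hdiv : (i + q * m) / (m : ℤ) = q := by
      rw [Int.add_mul_ediv_right _ _ (by omega), Int.ediv_eq_zero_of_lt (by omega) (by omega),
        zero_add]
    have hv' := wordBall_subset_succ X j hv
    have hi'' : |i - K| ≤ (j + 1 : ℕ) := hi.trans (by simp)
    have hpow : ∀ a v, blockEval g m (Coprod.inl a) (g ^ q * v, i + q * m) =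
        (g ^ q * (a * v), i + q * m) := fun a v => by
      rw [blockEval_inl, hdiv]; simp [mul_assoc]
    simp only [map_mul, Equiv.Perm.mul_apply, hvw]
    rcases hs with rfl | (rfl | rfl | ⟨a, ha, rfl⟩) | hs
    · exact ⟨v, hv', i, q, hi'', by simp⟩
    · exact ⟨v, hv', i + 1, q, abs_le.2 ⟨by push_cast; omega, by push_cast; omega⟩, by
        rw [blockEval_var, add_right_comm]⟩
    · refine ⟨v, hv', i, q + 1, hi'', ?_⟩
      rw [map_mul, Equiv.Perm.mul_apply, hpow, blockEval_var_pow, zpow_add_one, mul_assoc,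
        add_mul, one_mul, add_assoc]
    · exact ⟨a * v, mul_mem_wordBall_succ (.inr (.inl ha)) hv, i, q, hi'', hpow a v⟩
    · obtain ⟨s, rfl⟩ : ∃ t, s = t⁻¹ := ⟨s⁻¹, by simp⟩
      simp only [Set.mem_inv, inv_inv] at hs
      simp only [map_inv, Equiv.Perm.inv_eq_iff_eq]
      rcases hs with rfl | rfl | ⟨a, ha, rfl⟩
      · exact ⟨v, hv', i - 1, q, abs_le.2 ⟨by push_cast; omega, by push_cast; omega⟩, by
          rw [blockEval_var]; congr 1; ring⟩
      · refine ⟨v, hv', i, q - 1, hi'', ?_⟩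
        have hdiv' : (i + (q - 1) * m) / (m : ℤ) = q - 1 := by
          rw [Int.add_mul_ediv_right _ _ (by omega), Int.ediv_eq_zero_of_lt (by omega) (by omega),
            zero_add]
        rw [map_mul, Equiv.Perm.mul_apply, blockEval_inl, hdiv', blockEval_var_pow, zpow_sub_one]
        congr 1
        · group
        · ring
      · exact ⟨a⁻¹ * v, mul_mem_wordBall_succ (.inr (.inr (by simpa using ha))) hv, i, q, hi'', by
          rw [hpow, mul_inv_cancel_left]⟩

lemma mem_wordBall_of_inl_mem {X : Set G} {k : ℕ} (hm : 2 * k < m) {t : G}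
    (ht : Coprod.inl t ∈ wordBall (genericGenerators X g m) k) : t ∈ wordBall X k := by
  obtain ⟨v, hv, i, q, hi, h⟩ := exists_blockEval_eq le_rfl hm ht
  have hi' := abs_le.1 hi
  rw [blockEval_inl, Int.ediv_eq_zero_of_lt (by omega) (by omega)] at h
  simp only [zpow_zero, one_mul, inv_one, mul_one, Prod.mk.injEq] at h
  obtain ⟨rfl, h⟩ := h
  have hq : q = 0 := by
    have := congrArg (· / (m : ℤ)) h
    simpa [Int.add_mul_ediv_right _ _ (show (m : ℤ) ≠ 0 by omega),
      Int.ediv_eq_zero_of_lt (show 0 ≤ (k : ℤ) by omega) (show (k : ℤ) < m by omega),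
      Int.ediv_eq_zero_of_lt (show 0 ≤ i by omega) (show i < m by omega)] using this.symm
  simpa [hq] using hv

end BlockAction

/-- A finite generating set together with finitely many promises `(t, k)`, stating that `t` is
not a product of at most `k` generators and their inverses. -/
def PromisedGenerators (G : Type*) [Group G] : Type _ :=
  {p : Set G × Set (G × ℕ) // p.1.Finite ∧ p.2.Finite ∧ ∀ t ∈ p.2, t.1 ∉ wordBall p.1 t.2}

instance : PartialOrder (PromisedGenerators G) :=
  inferInstanceAs (PartialOrder (Subtype _))

lemma MIF.isCofinal_mem_closure (hG : MIF G) (g : G) :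
    IsCofinal {p : PromisedGenerators G | g ∈ Subgroup.closure p.1.1} := by
  rintro ⟨⟨X, T⟩, hX, hT, hXT⟩
  obtain ⟨K, hK⟩ := (hT.image fun t => t.2).bddAbove
  let Y := genericGenerators X g (2 * K + 1)
  have hY : Y.Finite := ((hX.image _).insert _).insert _
  obtain ⟨x, hx⟩ := hG.exists_forall_finite
    (S := ⋃ t ∈ T, (fun w => w * (Coprod.inl t.1)⁻¹) '' wordBall Y t.2)
    (hT.biUnion fun t _ => (finite_wordBall hY _).image _) (by
      simp only [mem_iUnion, mem_image, mul_inv_eq_one, not_exists, not_and]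
      rintro t ht _ hw rfl
      have : t.2 ≤ K := hK (mem_image_of_mem _ ht)
      exact hXT t ht (mem_wordBall_of_inl_mem (by omega) hw))
  refine ⟨⟨⟨eval (MonoidHom.id G) x '' Y, T⟩, hY.image _, hT, fun t ht h => ?_⟩, ?_, ?_, subset_rfl⟩
  · simp only [← image_wordBall] at h
    obtain ⟨w, hw, hwt⟩ := h
    exact hx (w * (Coprod.inl t.1)⁻¹) (mem_biUnion ht (mem_image_of_mem _ hw)) (by simp [hwt])
  · have hxm : x ∈ Subgroup.closure (eval (MonoidHom.id G) x '' Y) :=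
      Subgroup.subset_closure ⟨var, mem_insert _ _, by simp⟩
    have hgm : x ^ (2 * K + 1) * g ∈ Subgroup.closure (eval (MonoidHom.id G) x '' Y) :=
      Subgroup.subset_closure ⟨var ^ (2 * K + 1) * Coprod.inl g, .inr (.inl rfl), by simp⟩
    exact (Subgroup.mul_mem_cancel_left _ (pow_mem hxm _)).1 hgm
  · exact fun a ha => ⟨Coprod.inl a, .inr (.inr (mem_image_of_mem _ ha)), by simp⟩

lemma MIF.isCofinal_exists_promise (hG : MIF G) (k : ℕ) :
    IsCofinal {p : PromisedGenerators G | ∃ t, (t, k) ∈ p.1.2} := by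
  rintro ⟨⟨X, T⟩, hX, hT, hXT⟩
  obtain ⟨t, ht⟩ := hG.exists_forall_finite
    (S := (fun b => var * Coprod.inl b⁻¹) '' wordBall X k) ((finite_wordBall hX k).image _) (by
      rintro ⟨b, -, hb⟩
      exact var_mul_inl_ne_one _ hb)
  refine ⟨⟨⟨X, insert (t, k) T⟩, hX, hT.insert _, ?_⟩, ⟨t, mem_insert _ _⟩, subset_rfl,
    subset_insert _ _⟩
  simp only [mem_insert_iff, forall_eq_or_imp]
  exact ⟨fun h => ht _ (mem_image_of_mem _ h) (by simp), hXT⟩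

lemma Order.Ideal.exists_forall_mem_generators (I : Order.Ideal (PromisedGenerators G))
    {p : PromisedGenerators G} (hp : p ∈ I) (l : List G)
    (hl : ∀ x ∈ l, ∃ q ∈ I, x ∈ q.1.1 ∨ x⁻¹ ∈ q.1.1) :
    ∃ q ∈ I, p ≤ q ∧ ∀ x ∈ l, x ∈ q.1.1 ∨ x⁻¹ ∈ q.1.1 := by
  induction l with
  | nil => exact ⟨p, hp, le_rfl, by simp⟩
  | cons x l ih =>
    simp only [List.mem_cons, forall_eq_or_imp] at hl ⊢
    obtain ⟨q, hq, hpq, hql⟩ := ih hl.2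
    obtain ⟨r, hr, hrx⟩ := hl.1
    obtain ⟨s, hs, hqs, hrs⟩ := I.directed q hq r hr
    exact ⟨s, hs, hpq.trans hqs, hrx.imp (fun h => hrs.1 h) (fun h => hrs.1 h),
      fun y hy => (hql y hy).imp (fun h => hqs.1 h) (fun h => hqs.1 h)⟩

end

theorem stmt3 (G : Type) [Group G] [Countable G] (hG : MIF G) :
    ∃ X : Set G, Subgroup.closure X = ⊤ ∧ ∀ C : ℕ, ∃ g : G, C < wordLength X g := by
  have := Encodable.ofCountable G
  let D : G ⊕ ℕ → Order.Cofinal (PromisedGenerators G) :=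
    Sum.elim (fun g => ⟨_, hG.isCofinal_mem_closure g⟩) fun k => ⟨_, hG.isCofinal_exists_promise k⟩
  obtain ⟨I, hIg, hIk⟩ : ∃ I : Order.Ideal (PromisedGenerators G),
      (∀ g, ∃ p ∈ I, g ∈ Subgroup.closure p.1.1) ∧ ∀ k, ∃ p ∈ I, ∃ t, (t, k) ∈ p.1.2 := by
    let p₀ : PromisedGenerators G := ⟨(∅, ∅), finite_empty, finite_empty, by simp⟩
    refine ⟨Order.idealOfCofinals p₀ D, fun g => ?_, fun k => ?_⟩
    · obtain ⟨p, hp, hpI⟩ := Order.cofinal_meets_idealOfCofinals p₀ D (.inl g)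
      exact ⟨p, hpI, hp⟩
    · obtain ⟨p, hp, hpI⟩ := Order.cofinal_meets_idealOfCofinals p₀ D (.inr k)
      exact ⟨p, hpI, hp⟩
  have hX : Subgroup.closure (⋃ p ∈ I, p.1.1) = ⊤ := by
    refine (Subgroup.eq_top_iff' _).2 fun g => ?_
    obtain ⟨p, hpI, hp⟩ := hIg g
    have hpX : p.1.1 ⊆ ⋃ p ∈ I, p.1.1 := fun x hx => mem_iUnion₂.2 ⟨p, hpI, hx⟩
    exact Subgroup.closure_mono hpX hp
  refine ⟨_, hX, fun C => ?_⟩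
  obtain ⟨p, hpI, t, ht⟩ := hIk C
  refine ⟨t, lt_of_not_ge fun h => ?_⟩
  obtain ⟨l, hlen, hl, rfl⟩ := exists_list_of_closure_eq_top hX t
  obtain ⟨q, -, hpq, hq⟩ := I.exists_forall_mem_generators hpI l fun x hx => by
    rcases hl x hx with h | h <;> simp only [mem_iUnion] at h <;> obtain ⟨r, hr, h⟩ := h
    exacts [⟨r, hr, .inl h⟩, ⟨r, hr, .inr h⟩]
  exact q.2.2.2 _ (hpq.2 ht) (prod_mem_wordBall hq (hlen.trans_le h))
end
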